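/- Let u > 0 and let φ : [0,u] → ℝ be an index function (continuous, non-decreasing, with φ(0) = 0) such that φ(x) > 0 for all x ∈ (0,u]. Suppose φ is covered by the qualification ν > 0 with constant c > 0, i.e. for every λ ∈ (0,u] one has c·λ^ν/φ(λ) ≤ inf_{σ ∈ [λ,u]} σ^ν/φ(σ). Then for every λ ∈ (0,u], sup_{0 ≤ x ≤ u} φ(x)/(x+λ)^ν ≤ max{1, 1/c} · φ(λ)/λ^ν. -/

import Mathlib

/-- If an index function `φ` on `[0,u]` (continuous, non-decreasing,
`φ 0 = 0`, positive on `(0,u]`) is covered by the qualification `ν > 0` with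
constant `c > 0`, then for every `λ ∈ (0,u]`,
`sup_{0 ≤ x ≤ u} φ(x)/(x+λ)^ν ≤ max 1 (1/c) · φ(λ)/λ^ν`. -/
theorem stmt_0 (u ν c : ℝ) (φ : ℝ → ℝ) (hu : 0 < u) (hν : 0 < ν) (hc : 0 < c)
    (hcont : ContinuousOn φ (Set.Icc 0 u))
    (hmono : MonotoneOn φ (Set.Icc 0 u))
    (hφ0 : φ 0 = 0)
    (hφpos : ∀ x ∈ Set.Ioc 0 u, 0 < φ x)
    (hcover : ∀ lam ∈ Set.Ioc 0 u, ∀ σ ∈ Set.Icc lam u,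
      c * lam ^ ν / φ lam ≤ σ ^ ν / φ σ) :
    ∀ lam ∈ Set.Ioc 0 u, ∀ x ∈ Set.Icc 0 u,
      φ x / (x + lam) ^ ν ≤ max 1 (1 / c) * (φ lam / lam ^ ν) := by
  intro lam hlam x hx
  have hl : 0 < lam := hlam.1
  have hφl : 0 < φ lam := hφpos lam hlam
  have hlν : 0 < lam ^ ν := Real.rpow_pos_of_pos hl ν
  have hq : 0 ≤ φ lam / lam ^ ν := by positivity
  rcases le_total x lam with h | h
  · calc φ x / (x + lam) ^ ν ≤ φ lam / lam ^ ν :=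
          div_le_div₀ hφl.le (hmono hx ⟨hl.le, hlam.2⟩ h) hlν
            (Real.rpow_le_rpow hl.le (by linarith [hx.1]) hν.le)
      _ ≤ max 1 (1 / c) * (φ lam / lam ^ ν) := le_mul_of_one_le_left hq (le_max_left _ _)
  · have hx0 : 0 < x := hl.trans_le h
    have hφx : 0 < φ x := hφpos x ⟨hx0, hx.2⟩
    have hxν : 0 < x ^ ν := Real.rpow_pos_of_pos hx0 ν
    calc φ x / (x + lam) ^ ν ≤ φ x / x ^ ν :=
          div_le_div_of_nonneg_left hφx.le hxν
            (Real.rpow_le_rpow hx0.le (by linarith) hν.le)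
      _ ≤ 1 / c * (φ lam / lam ^ ν) := by
          have hcov := hcover lam hlam x ⟨h, hx.2⟩
          rw [div_le_div_iff₀ hφl hφx] at hcov
          rw [div_mul_div_comm, div_le_div_iff₀ hxν (by positivity)]
          linarith
      _ ≤ max 1 (1 / c) * (φ lam / lam ^ ν) :=
          mul_le_mul_of_nonneg_right (le_max_right _ _) hq
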